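/- arXiv:1705.01797 — 2 statements merged into one kernel-verified Lean document; each statement's English description precedes it below -/
import Mathlib

section
/- Assume q ≠ 0, let V ∈ ℝ^{n×(n−1)} have orthonormal columns spanning {q}^⊥, and let H_q = VᵀHV be positive definite. Let x ∈ Ω with q_{F(x)} ≠ 0, and let x̄ be the (unique) minimizer of f over Ω(x). Then f(x) − f(x̄) ≤ (1/2)·ζ_min(H_q)^{-1}·‖φ(x)‖². -/
noncomputable section

open Matrix
open scoped Classical

/-- Euclidean dot product. -/
def dotp {m : Type*} [Fintype m] (v w : m → ℝ) : ℝ := ∑ i, v i * w i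

/-- Euclidean norm. -/
def nrm {m : Type*} [Fintype m] (v : m → ℝ) : ℝ := Real.sqrt (∑ i, (v i) ^ 2)

/-- Objective f(x) = ½ xᵀHx − cᵀx. -/
def fObj {n : ℕ} (H : Matrix (Fin n) (Fin n) ℝ) (c x : Fin n → ℝ) : ℝ :=
  (1 / 2) * dotp x (H.mulVec x) - dotp c x

/-- Gradient ∇f(x) = Hx − c (for H symmetric). -/
def grad {n : ℕ} (H : Matrix (Fin n) (Fin n) ℝ) (c x : Fin n → ℝ) : Fin n → ℝ :=
  H.mulVec x - c

/-- Feasible set Ω = {x : qᵀx = b, l ≤ x ≤ u}. -/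
def OmegaSet {n : ℕ} (q : Fin n → ℝ) (b : ℝ) (l u : Fin n → ℝ) : Set (Fin n → ℝ) :=
  {x | dotp q x = b ∧ ∀ i, l i ≤ x i ∧ x i ≤ u i}

/-- Lower active set A_l(x). -/
def Al {n : ℕ} (l x : Fin n → ℝ) : Set (Fin n) := {i | x i = l i}

/-- Upper active set A_u(x). -/
def Au {n : ℕ} (u x : Fin n → ℝ) : Set (Fin n) := {i | x i = u i}

/-- Active set A(x). -/
def ASet {n : ℕ} (l u x : Fin n → ℝ) : Set (Fin n) := Al l x ∪ Au u x

/-- Free set F(x). -/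
def FSet {n : ℕ} (l u x : Fin n → ℝ) : Set (Fin n) := (ASet l u x)ᶜ

/-- ρ(x) = q_Fᵀ(∇f(x))_F / q_Fᵀq_F (0 if q_F = 0). -/
def rhoF {n : ℕ} (H : Matrix (Fin n) (Fin n) ℝ) (c q l u x : Fin n → ℝ) : ℝ :=
  if ∀ i ∈ FSet l u x, q i = 0 then 0
  else (∑ i, if i ∈ FSet l u x then q i * grad H c x i else 0) /
    (∑ i, if i ∈ FSet l u x then q i * q i else 0)

/-- h(x) = ∇f(x) − ρ(x) q. -/
def hVec {n : ℕ} (H : Matrix (Fin n) (Fin n) ℝ) (c q l u x : Fin n → ℝ) : Fin n → ℝ :=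
  fun i => grad H c x i - rhoF H c q l u x * q i

/-- Free gradient φ(x). -/
def phiVec {n : ℕ} (H : Matrix (Fin n) (Fin n) ℝ) (c q l u x : Fin n → ℝ) : Fin n → ℝ :=
  fun i => if i ∈ FSet l u x then hVec H c q l u x i else 0

/-- Tangent cone T_Ω(x). -/
def TCone {n : ℕ} (q l u x : Fin n → ℝ) : Set (Fin n → ℝ) :=
  {v | dotp q v = 0 ∧ (∀ i ∈ Al l x, 0 ≤ v i) ∧ (∀ i ∈ Au u x, v i ≤ 0)}

/-- g is the projected gradient ∇_Ω f(x): the minimizer of ‖v + ∇f(x)‖ over v ∈ T_Ω(x). -/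
def IsProjGrad {n : ℕ} (H : Matrix (Fin n) (Fin n) ℝ) (c q l u x g : Fin n → ℝ) : Prop :=
  g ∈ TCone q l u x ∧ ∀ v ∈ TCone q l u x, nrm (g + grad H c x) ≤ nrm (v + grad H c x)

/-- Chopped gradient β(x) = −∇_Ω f(x) − φ(x), where g = ∇_Ω f(x). -/
def betaVec {n : ℕ} (H : Matrix (Fin n) (Fin n) ℝ) (c q l u x g : Fin n → ℝ) : Fin n → ℝ :=
  -g - phiVec H c q l u x

/-- Binding set B(x). -/
def BSet {n : ℕ} (H : Matrix (Fin n) (Fin n) ℝ) (c q l u x : Fin n → ℝ) : Set (Fin n) :=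
  {i | (i ∈ Al l x ∧ 0 ≤ hVec H c q l u x i) ∨ (i ∈ Au u x ∧ hVec H c q l u x i ≤ 0)}

/-- Affine closure Ω(x) of the face determined by the active set at x. -/
def OmegaFace {n : ℕ} (q : Fin n → ℝ) (b : ℝ) (l u x : Fin n → ℝ) : Set (Fin n → ℝ) :=
  {v | dotp q v = b ∧ ∀ i ∈ ASet l u x, v i = x i}

/-- Ω₀(x). -/
def Omega0 {n : ℕ} (q l u x : Fin n → ℝ) : Set (Fin n → ℝ) :=
  {v | dotp q v = 0 ∧ ∀ i ∈ ASet l u x, v i = 0}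

/-- KKT stationarity: ∇f(x) = Σ_{i∈A(x)} λᵢ eᵢ + ρ q with sign conditions. -/
def Stationary {n : ℕ} (H : Matrix (Fin n) (Fin n) ℝ) (c q : Fin n → ℝ) (b : ℝ)
    (l u x : Fin n → ℝ) : Prop :=
  x ∈ OmegaSet q b l u ∧
    ∃ (ρs : ℝ) (lam : Fin n → ℝ),
      (∀ i, grad H c x i = lam i + ρs * q i) ∧
      (∀ i ∈ FSet l u x, lam i = 0) ∧
      (∀ i ∈ Al l x, 0 ≤ lam i) ∧ (∀ i ∈ Au u x, lam i ≤ 0)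

/-- Lagrange multiplier estimate λ(x). -/
def lamEst {n : ℕ} (H : Matrix (Fin n) (Fin n) ℝ) (c q l u x : Fin n → ℝ) : Fin n → ℝ :=
  fun i =>
    if i ∈ Al l x then max 0 (hVec H c q l u x i)
    else if i ∈ Au u x then min 0 (hVec H c q l u x i) else 0

/-- ζ is the smallest eigenvalue of M. -/
def IsSmallestEigenvalue {m : Type*} [Fintype m] (M : Matrix m m ℝ) (ζ : ℝ) : Prop :=
  (∃ v : m → ℝ, v ≠ 0 ∧ M.mulVec v = ζ • v) ∧
    ∀ (μ : ℝ) (v : m → ℝ), v ≠ 0 → M.mulVec v = μ • v → ζ ≤ μ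

/-- ζ is the largest eigenvalue of M. -/
def IsLargestEigenvalue {m : Type*} [Fintype m] (M : Matrix m m ℝ) (ζ : ℝ) : Prop :=
  (∃ v : m → ℝ, v ≠ 0 ∧ M.mulVec v = ζ • v) ∧
    ∀ (μ : ℝ) (v : m → ℝ), v ≠ 0 → M.mulVec v = μ • v → μ ≤ ζ

/-- t is the spectral (ℓ₂ operator) norm of M. -/
def IsSpectralNorm {m k : Type*} [Fintype m] [Fintype k] (M : Matrix m k ℝ) (t : ℝ) : Prop :=
  IsLeast {s : ℝ | 0 ≤ s ∧ ∀ v : k → ℝ, nrm (M.mulVec v) ≤ s * nrm v} t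

theorem dotp_eq_dotProduct {m : Type*} [Fintype m] (v w : m → ℝ) : dotp v w = v ⬝ᵥ w := rfl

theorem nrm_sq {m : Type*} [Fintype m] (v : m → ℝ) : nrm v ^ 2 = v ⬝ᵥ v := by
  rw [nrm, Real.sq_sqrt (Finset.sum_nonneg fun i _ => sq_nonneg _)]
  simp only [dotProduct, sq]

/-- If the columns of `V` are an orthonormal basis of the orthogonal complement of `q`, then
`V * Vᵀ` fixes every vector orthogonal to `q`. -/
theorem mulVec_transpose_mulVec_of_dotProduct_eq_zero {n : ℕ} {q : Fin n → ℝ} (hq : q ≠ 0)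
    {V : Matrix (Fin n) (Fin (n - 1)) ℝ} (hVorth : Vᵀ * V = 1) (hVq : q ᵥ* V = 0)
    {d : Fin n → ℝ} (hd : q ⬝ᵥ d = 0) : V *ᵥ (Vᵀ *ᵥ d) = d := by
  have hn : n ≠ 0 := by
    rintro rfl
    exact hq (Subsingleton.elim _ _)
  have hqq : q ⬝ᵥ q ≠ 0 := fun h => hq (dotProduct_self_eq_zero.mp h)
  have hcard : Fintype.card (Fin (n - 1) ⊕ Unit) = Fintype.card (Fin n) := by
    simp only [Fintype.card_sum, Fintype.card_fin, Fintype.card_unit]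
    omega
  have hBA : fromRows Vᵀ (replicateRow Unit ((q ⬝ᵥ q)⁻¹ • q)) *
      fromCols V (replicateCol Unit q) = 1 := by
    rw [fromRows_mul_fromCols, hVorth, ← fromBlocks_one]
    congr 1
    · ext i j
      have := congrFun hVq i
      simpa [mul_apply, vecMul, dotProduct, mul_comm] using this
    · ext i j
      have := congrFun hVq j
      simp only [vecMul, dotProduct, Pi.zero_apply] at this
      simp [mul_apply, mul_assoc, ← Finset.mul_sum, this]
    · ext i j
      simp only [mul_apply, replicateRow_apply, replicateCol_apply, Pi.smul_apply, smul_eq_mul,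
        mul_assoc, ← Finset.mul_sum]
      simpa [dotProduct] using inv_mul_cancel₀ hqq
  have hAB := (mul_eq_one_comm_of_equiv (Fintype.equivOfCardEq hcard)).mp hBA
  rw [fromCols_mul_fromRows] at hAB
  have hrow : replicateRow Unit ((q ⬝ᵥ q)⁻¹ • q) *ᵥ d = 0 := by
    ext i
    change ((q ⬝ᵥ q)⁻¹ • q) ⬝ᵥ d = 0
    rw [smul_dotProduct, hd, smul_zero]
  have := congrArg (· *ᵥ d) hAB
  simpa only [add_mulVec, ← mulVec_mulVec, hrow, mulVec_zero, add_zero, one_mulVec] using this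

theorem IsSmallestEigenvalue.mul_dotProduct_self_le {m : Type*} [Fintype m] {M : Matrix m m ℝ}
    {ζ : ℝ} (hζ : IsSmallestEigenvalue M ζ) (hM : M.IsHermitian) (w : m → ℝ) :
    ζ * (w ⬝ᵥ w) ≤ w ⬝ᵥ M *ᵥ w := by
  have hS : (M - ζ • (1 : Matrix m m ℝ)).IsHermitian := by
    refine hM.sub ?_
    simp [IsHermitian]
  have hpsd : (M - ζ • (1 : Matrix m m ℝ)).PosSemidef := by
    refine hS.posSemidef_iff_eigenvalues_nonneg.mpr fun j => ?_
    have hj := hS.mulVec_eigenvectorBasis j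
    have hne : (hS.eigenvectorBasis j : m → ℝ) ≠ 0 := fun h =>
      hS.eigenvectorBasis.orthonormal.ne_zero j (by ext i; exact congrFun h i)
    rw [sub_mulVec, smul_mulVec, one_mulVec, sub_eq_iff_eq_add, ← add_smul] at hj
    have := hζ.2 _ _ hne hj
    simpa using this
  have := hpsd.dotProduct_mulVec_nonneg w
  rw [sub_mulVec, smul_mulVec, one_mulVec, dotProduct_sub, dotProduct_smul] at this
  simpa using this

theorem IsSmallestEigenvalue.pos {m : Type*} [Fintype m] {M : Matrix m m ℝ}
    {ζ : ℝ} (hζ : IsSmallestEigenvalue M ζ) (hM : M.PosDef) : 0 < ζ := by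
  obtain ⟨⟨v, hv, hMv⟩, -⟩ := hζ
  have h := hM.dotProduct_mulVec_pos hv
  rw [hMv, dotProduct_smul, star_trivial, smul_eq_mul] at h
  exact pos_of_mul_pos_left h (dotProduct_self_star_nonneg v)

theorem fObj_sub_fObj {n : ℕ} {H : Matrix (Fin n) (Fin n) ℝ} (hH : H.IsSymm)
    (c x y : Fin n → ℝ) :
    fObj H c x - fObj H c y =
      -(grad H c x ⬝ᵥ (y - x)) - (1 / 2) * ((y - x) ⬝ᵥ H *ᵥ (y - x)) := by
  have hsymm : y ⬝ᵥ H *ᵥ x = x ⬝ᵥ H *ᵥ y := by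
    rw [dotProduct_mulVec, ← mulVec_transpose, hH.eq, dotProduct_comm]
  simp only [fObj, grad, dotp_eq_dotProduct, mulVec_sub, sub_dotProduct, dotProduct_sub,
    dotProduct_comm (H *ᵥ x), hsymm]
  ring

/-- Along directions of the face of `x`, the free gradient represents the gradient. -/
theorem phiVec_dotProduct {n : ℕ} (H : Matrix (Fin n) (Fin n) ℝ) (c : Fin n → ℝ)
    {q l u x d : Fin n → ℝ} (hd : d ∈ Omega0 q l u x) :
    phiVec H c q l u x ⬝ᵥ d = grad H c x ⬝ᵥ d := by
  have h : phiVec H c q l u x ⬝ᵥ d = (grad H c x - rhoF H c q l u x • q) ⬝ᵥ d := by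
    refine Finset.sum_congr rfl fun i _ => ?_
    by_cases hi : i ∈ FSet l u x
    · simp [phiVec, hVec, hi]
    · simp [hd.2 i (not_not.mp hi)]
  rw [h, sub_dotProduct, smul_dotProduct, ← dotp_eq_dotProduct q, hd.1, smul_zero, sub_zero]

/-- f(x) − f(x̄) ≤ ½ ζ_min(H_q)⁻¹ ‖φ(x)‖², where x̄ minimizes f over Ω(x). -/
theorem stmt_15 {n : ℕ} (hn : 2 ≤ n)
    (H : Matrix (Fin n) (Fin n) ℝ) (hH : H.IsSymm)
    (c q l u : Fin n → ℝ) (b : ℝ) (hlu : ∀ i, l i < u i) (hq : q ≠ 0)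
    (V : Matrix (Fin n) (Fin (n - 1)) ℝ)
    (hVorth : Vᵀ * V = 1) (hVq : Matrix.vecMul q V = 0)
    (hHq : (Vᵀ * H * V).PosDef)
    (ζ : ℝ) (hζ : IsSmallestEigenvalue (Vᵀ * H * V) ζ)
    (x : Fin n → ℝ) (hx : x ∈ OmegaSet q b l u)
    (hqF : ∃ i ∈ FSet l u x, q i ≠ 0)
    -- x̄ is the (unique) minimizer of f over Ω(x)
    (xb : Fin n → ℝ) (hxbF : xb ∈ OmegaFace q b l u x)
    (hxbmin : ∀ v ∈ OmegaFace q b l u x, fObj H c xb ≤ fObj H c v) :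
    fObj H c x - fObj H c xb ≤ (1 / 2) * ζ⁻¹ * nrm (phiVec H c q l u x) ^ 2 := by
  set d := xb - x with hd_def
  have hd : d ∈ Omega0 q l u x := by
    refine ⟨?_, fun i hi => sub_eq_zero.mpr (hxbF.2 i hi)⟩
    have h₁ := hxbF.1
    have h₂ := hx.1
    rw [dotp_eq_dotProduct] at *
    rw [hd_def, dotProduct_sub, h₁, h₂, sub_self]
  have hVd : V *ᵥ (Vᵀ *ᵥ d) = d :=
    mulVec_transpose_mulVec_of_dotProduct_eq_zero hq hVorth hVq hd.1
  have hnorm : (Vᵀ *ᵥ d) ⬝ᵥ (Vᵀ *ᵥ d) = d ⬝ᵥ d := by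
    rw [mulVec_transpose, ← dotProduct_mulVec, ← mulVec_transpose, hVd]
  have hquad : (Vᵀ *ᵥ d) ⬝ᵥ (Vᵀ * H * V) *ᵥ (Vᵀ *ᵥ d) = d ⬝ᵥ H *ᵥ d := by
    rw [← mulVec_mulVec, hVd, ← mulVec_mulVec, dotProduct_mulVec, vecMul_transpose, hVd]
  have hcurv := hζ.mul_dotProduct_self_le hHq.isHermitian (Vᵀ *ᵥ d)
  rw [hnorm, hquad] at hcurv
  have hpos : 0 < ζ := hζ.pos hHq
  set p := phiVec H c q l u x with hp
  have hsq : 0 ≤ (p + ζ • d) ⬝ᵥ (p + ζ • d) := dotProduct_self_star_nonneg _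
  simp only [add_dotProduct, dotProduct_add, smul_dotProduct, dotProduct_smul, smul_eq_mul,
    dotProduct_comm d p] at hsq
  have hcomplete : 0 ≤ ζ⁻¹ * (p ⬝ᵥ p) + 2 * (p ⬝ᵥ d) + ζ * (d ⬝ᵥ d) := by
    have := mul_nonneg (inv_pos.mpr hpos).le hsq
    field_simp at this ⊢
    linarith
  rw [fObj_sub_fObj hH, ← hd_def, ← phiVec_dotProduct H c hd, ← hp, nrm_sq]
  linarith
end
end

section
/- Let H ∈ ℝ^{n×n} be symmetric, q ∈ ℝⁿ with q ≠ 0, and F ⊆ {1,…,n} with q_F ≠ 0. Let V ∈ ℝ^{n×(n−1)} have orthonormal columns spanning {q}^⊥, H_q = VᵀHV, and let W ∈ ℝ^{|F|×(|F|−1)} have orthonormal columns spanning {q_F}^⊥ in ℝ^{|F|}. Then ζ_max(WᵀH_{FF}W) ≤ ζ_max(H_q) and ζ_min(WᵀH_{FF}W) ≥ ζ_min(H_q); hence, if H_q is positive definite, κ(WᵀH_{FF}W) ≤ κ(H_q), where κ denotes the spectral condition number ζ_max/ζ_min. -/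
noncomputable section

open Matrix
open scoped Classical

/-- A lower bound on the eigenvalues of a symmetric matrix bounds its quadratic form from below. -/
lemma mul_dotProduct_self_le_of_forall_eigenvalue {m : Type*} [Fintype m] {A : Matrix m m ℝ}
    (hA : A.IsSymm) {ζ : ℝ} (h : ∀ (μ : ℝ) (v : m → ℝ), v ≠ 0 → A *ᵥ v = μ • v → ζ ≤ μ)
    (x : m → ℝ) : ζ * (x ⬝ᵥ x) ≤ x ⬝ᵥ A *ᵥ x := by
  have hB : (A - ζ • (1 : Matrix m m ℝ)).IsHermitian := by
    rw [Matrix.isHermitian_iff_isSymm]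
    exact hA.sub (Matrix.isSymm_one.smul ζ)
  have hpos : (A - ζ • (1 : Matrix m m ℝ)).PosSemidef := by
    rw [hB.posSemidef_iff_eigenvalues_nonneg]
    intro j
    have hv := hB.mulVec_eigenvectorBasis j
    have hne : (hB.eigenvectorBasis j : m → ℝ) ≠ 0 := by
      intro h0
      exact hB.eigenvectorBasis.orthonormal.ne_zero j (by ext k; exact congrFun h0 k)
    rw [Matrix.sub_mulVec, Matrix.smul_mulVec, Matrix.one_mulVec, sub_eq_iff_eq_add,
      ← add_smul] at hv
    have := h _ _ hne hv
    simpa using this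
  have hx := hpos.dotProduct_mulVec_nonneg x
  rw [Matrix.sub_mulVec, Matrix.smul_mulVec, Matrix.one_mulVec, dotProduct_sub,
    dotProduct_smul, star_trivial, smul_eq_mul] at hx
  linarith

/-- Eigenvalues of a compression of a symmetric matrix respect lower eigenvalue bounds. -/
lemma le_eigenvalue_compression {m k : Type*} [Fintype m] [Fintype k]
    [DecidableEq k] {A : Matrix m m ℝ}
    (hA : A.IsSymm) {U : Matrix m k ℝ} (hU : Uᵀ * U = 1) {ζ : ℝ}
    (h : ∀ (μ : ℝ) (v : m → ℝ), v ≠ 0 → A *ᵥ v = μ • v → ζ ≤ μ)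
    {μ : ℝ} {v : k → ℝ} (hv : v ≠ 0) (hμ : (Uᵀ * A * U) *ᵥ v = μ • v) : ζ ≤ μ := by
  have key := mul_dotProduct_self_le_of_forall_eigenvalue hA h (U *ᵥ v)
  have move (y : m → ℝ) : (U *ᵥ v) ⬝ᵥ y = v ⬝ᵥ Uᵀ *ᵥ y := by
    rw [Matrix.dotProduct_mulVec, Matrix.vecMul_transpose]
  rw [move, move, Matrix.mulVec_mulVec, hU, Matrix.one_mulVec, Matrix.mulVec_mulVec,
    Matrix.mulVec_mulVec, hμ, dotProduct_smul, smul_eq_mul] at key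
  have hvv : 0 < v ⬝ᵥ v :=
    lt_of_le_of_ne (Finset.sum_nonneg fun i _ => mul_self_nonneg (v i))
      fun h0 => hv (dotProduct_self_eq_zero.mp h0.symm)
  exact le_of_mul_le_mul_right key hvv

/-- Eigenvalues of a compression of a symmetric matrix respect upper eigenvalue bounds. -/
lemma eigenvalue_compression_le {m k : Type*} [Fintype m] [Fintype k]
    [DecidableEq k] {A : Matrix m m ℝ}
    (hA : A.IsSymm) {U : Matrix m k ℝ} (hU : Uᵀ * U = 1) {ζ : ℝ}
    (h : ∀ (μ : ℝ) (v : m → ℝ), v ≠ 0 → A *ᵥ v = μ • v → μ ≤ ζ)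
    {μ : ℝ} {v : k → ℝ} (hv : v ≠ 0) (hμ : (Uᵀ * A * U) *ᵥ v = μ • v) : μ ≤ ζ := by
  refine neg_le_neg_iff.mp (le_eigenvalue_compression (A := -A) hA.neg hU ?_ hv ?_)
  · intro ν w hw hν
    rw [Matrix.neg_mulVec, neg_eq_iff_eq_neg, ← neg_smul] at hν
    exact neg_le.mp (h _ _ hw hν)
  · rw [Matrix.mul_neg, Matrix.neg_mul, Matrix.neg_mulVec, hμ, neg_smul]

/-- If the columns of `V` form an orthonormal basis of `{q}^⊥`, then `V * Vᵀ` is the orthogonal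
projection onto `{q}^⊥`, and so fixes every matrix whose columns are orthogonal to `q`. -/
lemma mul_transpose_mul_eq_self_of_vecMul_eq_zero {m k l : Type*} [Fintype m] [Fintype k]
    [DecidableEq m] [DecidableEq k]
    (hcard : Fintype.card m = Fintype.card k + 1) {q : m → ℝ} (hq : q ≠ 0)
    {V : Matrix m k ℝ} (hV : Vᵀ * V = 1) (hVq : q ᵥ* V = 0)
    {X : Matrix m l ℝ} (hX : q ᵥ* X = 0) : V * (Vᵀ * X) = X := by
  have hqq : q ⬝ᵥ q ≠ 0 := fun h0 => hq (dotProduct_self_eq_zero.mp h0)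
  have hVq' : Vᵀ *ᵥ q = 0 := by rw [Matrix.mulVec_transpose, hVq]
  have hPQ : Matrix.fromRows Vᵀ (Matrix.replicateRow Unit ((q ⬝ᵥ q)⁻¹ • q)) *
      Matrix.fromCols V (Matrix.replicateCol Unit q) = 1 := by
    rw [Matrix.fromRows_mul_fromCols, hV, ← Matrix.replicateCol_mulVec, hVq',
      ← Matrix.replicateRow_vecMul, Matrix.smul_vecMul, hVq, smul_zero,
      ← Matrix.fromBlocks_one]
    congr 1
    ext i j
    simp [Matrix.mul_apply]
    have : ∑ x, (q ⬝ᵥ q)⁻¹ * q x * q x = (q ⬝ᵥ q)⁻¹ * (q ⬝ᵥ q) := by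
      simp only [dotProduct, Finset.mul_sum, mul_assoc]
    rw [this, inv_mul_cancel₀ hqq]
  replace hPQ := (Matrix.mul_eq_one_comm_of_card_eq _ _ _ (by simp [hcard])).mp hPQ
  rw [Matrix.fromCols_mul_fromRows] at hPQ
  have hrow : Matrix.replicateRow Unit ((q ⬝ᵥ q)⁻¹ • q) * X = 0 := by
    rw [← Matrix.replicateRow_vecMul, Matrix.smul_vecMul, hX, smul_zero]
    rfl
  calc V * (Vᵀ * X) = (V * Vᵀ + Matrix.replicateCol Unit q *
        Matrix.replicateRow Unit ((q ⬝ᵥ q)⁻¹ • q)) * X := by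
        rw [Matrix.add_mul, Matrix.mul_assoc, Matrix.mul_assoc, hrow, Matrix.mul_zero, add_zero]
    _ = X := by rw [hPQ, Matrix.one_mul]

/-- ζ_max(WᵀH_FF W) ≤ ζ_max(H_q), ζ_min(WᵀH_FF W) ≥ ζ_min(H_q);
hence κ(WᵀH_FF W) ≤ κ(H_q) when H_q is positive definite. -/
theorem stmt_18 {n : ℕ} (hn : 2 ≤ n)
    (H : Matrix (Fin n) (Fin n) ℝ) (hH : H.IsSymm)
    (q : Fin n → ℝ) (hq : q ≠ 0)
    (F : Finset (Fin n)) (hqF : ∃ i ∈ F, q i ≠ 0)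
    (V : Matrix (Fin n) (Fin (n - 1)) ℝ)
    (hVorth : Vᵀ * V = 1) (hVq : Matrix.vecMul q V = 0)
    (W : Matrix {i // i ∈ F} (Fin (F.card - 1)) ℝ)
    (hWorth : Wᵀ * W = 1)
    (hWq : Matrix.vecMul (fun i : {i // i ∈ F} => q i) W = 0)
    (ζmin ζmax ζminW ζmaxW : ℝ)
    (hζmin : IsSmallestEigenvalue (Vᵀ * H * V) ζmin)
    (hζmax : IsLargestEigenvalue (Vᵀ * H * V) ζmax)
    (hζminW : IsSmallestEigenvalue
      (Wᵀ * H.submatrix (Subtype.val : {i // i ∈ F} → Fin n) Subtype.val * W) ζminW)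
    (hζmaxW : IsLargestEigenvalue
      (Wᵀ * H.submatrix (Subtype.val : {i // i ∈ F} → Fin n) Subtype.val * W) ζmaxW) :
    ζmaxW ≤ ζmax ∧ ζmin ≤ ζminW ∧
      ((Vᵀ * H * V).PosDef → ζmaxW / ζminW ≤ ζmax / ζmin) := by
  set E : Matrix (Fin n) {i // i ∈ F} ℝ := (1 : Matrix (Fin n) (Fin n) ℝ).submatrix id Subtype.val
    with hE
  have hEHE : Eᵀ * H * E = H.submatrix Subtype.val Subtype.val := by
    ext i j
    simp [hE, Matrix.mul_apply, Matrix.one_apply]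
  have hEE : Eᵀ * E = 1 := by
    ext i j
    simp [hE, Matrix.mul_apply, Matrix.one_apply]
  have hqE : q ᵥ* E = fun i : {i // i ∈ F} => q i := by
    ext i
    simp [hE, Matrix.vecMul, dotProduct, Matrix.one_apply]
  have hVU : V * (Vᵀ * (E * W)) = E * W :=
    mul_transpose_mul_eq_self_of_vecMul_eq_zero (by simp; omega) hq hVorth hVq
      (by rw [← Matrix.vecMul_vecMul, hqE, hWq])
  set U := Vᵀ * (E * W) with hU
  have hUt : Uᵀ = (E * W)ᵀ * V := by simp [hU, Matrix.transpose_mul]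
  have hUU : Uᵀ * U = 1 := by
    rw [hUt, Matrix.mul_assoc, hVU, Matrix.transpose_mul, Matrix.mul_assoc,
      ← Matrix.mul_assoc Eᵀ, hEE, Matrix.one_mul, hWorth]
  have hcomp : Wᵀ * H.submatrix (Subtype.val : {i // i ∈ F} → Fin n) Subtype.val * W =
      Uᵀ * (Vᵀ * H * V) * U := by
    have hVUt : Uᵀ * Vᵀ = (E * W)ᵀ := by rw [← Matrix.transpose_mul, hVU]
    calc _ = (E * W)ᵀ * H * (E * W) := by
            rw [← hEHE, Matrix.transpose_mul]
            refine (Matrix.mul_assoc _ _ _).trans ?_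
            simp only [Matrix.mul_assoc]
      _ = (Uᵀ * Vᵀ) * H * (V * U) := by rw [hVUt, hVU]
      _ = _ := by simp only [Matrix.mul_assoc]
  have hA : (Vᵀ * H * V).IsSymm := by
    rw [Matrix.IsSymm, Matrix.transpose_mul, Matrix.transpose_mul, hH.eq,
      Matrix.transpose_transpose, Matrix.mul_assoc]
  rw [hcomp] at hζminW hζmaxW
  obtain ⟨⟨w, hw, hw'⟩, hminW⟩ := hζminW
  obtain ⟨⟨z, hz, hz'⟩, -⟩ := hζmaxW
  have hmax : ζmaxW ≤ ζmax := eigenvalue_compression_le hA hUU hζmax.2 hz hz'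
  have hmin : ζmin ≤ ζminW := le_eigenvalue_compression hA hUU hζmin.2 hw hw'
  refine ⟨hmax, hmin, fun hpd => ?_⟩
  obtain ⟨⟨v, hv, hv'⟩, -⟩ := hζmin
  have hpos : 0 < ζmin := by
    have h := hpd.dotProduct_mulVec_pos hv
    rw [hv', dotProduct_smul, star_trivial, smul_eq_mul] at h
    exact pos_of_mul_pos_left h (Finset.sum_nonneg fun i _ => mul_self_nonneg (v i))
  have hminmax : ζminW ≤ ζmaxW := hminW _ _ hz hz'
  exact div_le_div₀ (by linarith) hmax hpos hmin
end
end
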